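/- Let Ω ⊆ ℤ^d be a finite 0-symmetric set containing the origin, and let m⁺ denote the number of points x = (x₁, …, x_d) ∈ Ω with x₁ ≥ 0. Then every positive definite function f : ℤ^d → ℂ with f(x) = 0 for all x ∉ Ω satisfies Re(∑_{x ∈ ℤ^d} f(x)) ≤ m⁺ · f(0). In other words, T_{ℤ^d}(Ω) ≤ m⁺. -/

import Mathlib

open Complex
open scoped ComplexOrder BigOperators

/-- A function on an abelian group is positive definite. -/
def IsPosDefFn {G : Type*} [AddCommGroup G] (f : G → ℂ) : Prop :=
  ∀ (N : ℕ) (x : Fin N → G) (c : Fin N → ℂ),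
    0 ≤ ∑ n : Fin N, ∑ m : Fin N, c n * (starRingEnd ℂ) (c m) * f (x n - x m)

open Filter Topology

/-- The quadratic form of the real part of a positive definite function is nonnegative on real
coefficients. -/
lemma IsPosDefFn.re_sum_nonneg {G : Type*} [AddCommGroup G] {f : G → ℂ} (hf : IsPosDefFn f)
    (s : Finset G) (c : G → ℝ) :
    0 ≤ ∑ x ∈ s, ∑ y ∈ s, c x * c y * (f (x - y)).re := by
  have h := hf s.card (fun i => (s.equivFin.symm i : G)) (fun i => (c (s.equivFin.symm i) : ℂ))
  have h' := (Complex.le_def.1 h).1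
  simp only [Complex.re_sum, Complex.zero_re, Complex.conj_ofReal, ← Complex.ofReal_mul,
    Complex.re_ofReal_mul] at h'
  rw [← Finset.sum_coe_sort s, ← Equiv.sum_comp s.equivFin.symm]
  refine h'.trans_eq (Finset.sum_congr rfl fun i _ => ?_)
  rw [← Finset.sum_coe_sort s, ← Equiv.sum_comp s.equivFin.symm]

lemma IsPosDefFn.re_zero_nonneg {G : Type*} [AddCommGroup G] {f : G → ℂ} (hf : IsPosDefFn f) :
    0 ≤ (f 0).re := by
  simpa using hf.re_sum_nonneg {0} 1

/-- Greedy selection: points are picked in order of increasing height `φ`, each one discarding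
at most as many points as `P` has elements. -/
lemma exists_dispersed_subset {G : Type*} [AddCommGroup G] [DecidableEq G] (φ : G →+ ℤ)
    (O P : Finset G) (h0 : 0 ∈ O) (hneg : ∀ x ∈ O, -x ∈ O) (hP : ∀ x ∈ O, 0 ≤ φ x → x ∈ P)
    (A : Finset G) :
    ∃ L ⊆ A, (∀ a ∈ L, ∀ b ∈ L, a - b ∈ O → a = b) ∧ A.card ≤ P.card * L.card := by
  induction A using Finset.strongInduction with
  | H A ih =>
    rcases A.eq_empty_or_nonempty with rfl | hA
    · exact ⟨∅, by simp⟩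
    obtain ⟨x, hxA, hx⟩ := A.exists_min_image φ hA
    set B := A.filter (fun y => ¬ y - x ∈ O) with hB
    have hxB : x ∉ B := by simp [hB, h0]
    have hBA : B ⊆ A := Finset.filter_subset _ _
    obtain ⟨L, hLB, hL, hcard⟩ := ih B ⟨hBA, fun h => hxB (h hxA)⟩
    have hfar : ∀ y ∈ L, y - x ∉ O := fun y hy => (Finset.mem_filter.1 (hLB hy)).2
    refine ⟨insert x L, Finset.insert_subset hxA (hLB.trans hBA), ?_, ?_⟩
    · intro a ha b hb hab
      rcases Finset.mem_insert.1 ha with rfl | haL <;> rcases Finset.mem_insert.1 hb with rfl | hbL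
      · rfl
      · exact absurd (by simpa using hneg _ hab) (hfar b hbL)
      · exact absurd hab (hfar a haL)
      · exact hL a haL b hbL hab
    · rw [Finset.card_insert_of_notMem fun h => hxB (hLB h)]
      have hdiscard : (A.filter (fun y => y - x ∈ O)).card ≤ P.card := by
        refine Finset.card_le_card_of_injOn (fun y => y - x) ?_ (sub_left_injective.injOn)
        intro y hy
        obtain ⟨hyA, hyO⟩ := Finset.mem_filter.1 hy
        exact hP _ hyO (by simpa using hx y hyA)
      have hsplit : (A.filter (fun y => y - x ∈ O)).card + B.card = A.card :=
        Finset.card_filter_add_card_filter_not _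
      rw [mul_add, mul_one]
      omega

lemma sum_sub_right_eq_finsum {G : Type*} [AddCommGroup G] {g : G → ℝ} {O A' : Finset G}
    (hg : Function.support g ⊆ O) (a : G) (ha : ∀ o ∈ O, a + o ∈ A') :
    ∑ y ∈ A', g (y - a) = ∑ᶠ x, g x := by
  rw [← finsum_comp_equiv (Equiv.subRight a)]
  refine (finsum_eq_sum_of_support_subset _ fun y hy => ?_).symm
  have := ha _ (hg (show y - a ∈ Function.support g from hy))
  simpa using this

lemma sum_sub_left_eq_finsum {G : Type*} [AddCommGroup G] {g : G → ℝ} {O A' : Finset G}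
    (hg : Function.support g ⊆ O) (hneg : ∀ x ∈ O, -x ∈ O) (a : G) (ha : ∀ o ∈ O, a + o ∈ A') :
    ∑ y ∈ A', g (a - y) = ∑ᶠ x, g x := by
  rw [← finsum_comp_equiv (Equiv.subLeft a)]
  refine (finsum_eq_sum_of_support_subset _ fun y hy => ?_).symm
  have := ha _ (hneg _ (hg (show a - y ∈ Function.support g from hy)))
  simpa using this

lemma sum_sub_left_le {G : Type*} [AddCommGroup G] [DecidableEq G] {g : G → ℝ} {O : Finset G}
    (hg : Function.support g ⊆ O) (A' : Finset G) (a : G) :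
    ∑ y ∈ A', g (a - y) ≤ ∑ x ∈ O, |g x| := by
  calc ∑ y ∈ A', g (a - y) ≤ ∑ y ∈ A', |g (a - y)| := Finset.sum_le_sum fun _ _ => le_abs_self _
    _ = ∑ x ∈ A'.image (a - ·), |g x| :=
      (Finset.sum_image (f := fun x => |g x|) sub_right_injective.injOn).symm
    _ ≤ ∑ x ∈ A'.image (a - ·) ∪ O, |g x| :=
      Finset.sum_le_sum_of_subset_of_nonneg Finset.subset_union_left fun _ _ _ => abs_nonneg _
    _ = ∑ x ∈ O, |g x| := by
      refine (Finset.sum_subset Finset.subset_union_right fun x _ hx => ?_).symm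
      rw [abs_eq_zero]
      by_contra h
      exact hx (hg h)

/-- The Turán bound up to a boundary term: test the quadratic form on the indicator of a dispersed
subset of `A`, minus a multiple of the indicator of a neighbourhood `A'` of `A`. -/
lemma IsPosDefFn.finsum_re_le_add_boundary {G : Type*} [AddCommGroup G] [DecidableEq G]
    {f : G → ℂ} (hf : IsPosDefFn f) (φ : G →+ ℤ) (O P : Finset G) (h0 : 0 ∈ O)
    (hneg : ∀ x ∈ O, -x ∈ O) (hP : ∀ x ∈ O, 0 ≤ φ x → x ∈ P)
    (hg : Function.support (fun x => (f x).re) ⊆ O) {A A' : Finset G} (hA : A.Nonempty)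
    (hA' : ∀ a ∈ A, ∀ o ∈ O, a + o ∈ A') :
    ∑ᶠ x, (f x).re ≤ P.card * (f 0).re +
      ((A'.card : ℝ) / A.card - 1) * ∑ x ∈ O, |(f x).re| := by
  obtain ⟨L, hLA, hL, hcard⟩ := exists_dispersed_subset φ O P h0 hneg hP A
  set g : G → ℝ := fun x => (f x).re with hgdef
  set M := ∑ x ∈ O, |g x| with hM
  set S := ∑ᶠ x, g x with hS
  have hAA' : A ⊆ A' := fun a ha => by simpa using hA' a ha 0 h0
  have hLA' : L ⊆ A' := hLA.trans hAA'
  have hApos : 0 < (A.card : ℝ) := by exact_mod_cast hA.card_pos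
  have hcardR : (A.card : ℝ) ≤ P.card * L.card := by exact_mod_cast hcard
  have hLpos : 0 < (L.card : ℝ) := by
    rcases Nat.eq_zero_or_pos L.card with h | h
    · rw [h] at hcardR
      rw [Nat.cast_zero, mul_zero] at hcardR
      linarith
    · exact_mod_cast h
  have hdiag : ∑ x ∈ L, ∑ y ∈ L, g (x - y) = L.card * g 0 := by
    rw [← nsmul_eq_mul]
    refine Finset.sum_eq_card_nsmul fun x hx => ?_
    rw [Finset.sum_eq_single_of_mem x hx, sub_self]
    intro y hy hyx
    by_contra h
    exact hyx (hL x hx y hy (hg h)).symm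
  have hleft : ∑ x ∈ L, ∑ y ∈ A', g (x - y) = L.card * S := by
    rw [← nsmul_eq_mul]
    exact Finset.sum_eq_card_nsmul fun x hx =>
      sum_sub_left_eq_finsum hg hneg x (hA' x (hLA hx))
  have hright : ∑ x ∈ A', ∑ y ∈ L, g (x - y) = L.card * S := by
    rw [Finset.sum_comm, ← nsmul_eq_mul]
    exact Finset.sum_eq_card_nsmul fun x hx => sum_sub_right_eq_finsum hg x (hA' x (hLA hx))
  have hfull : ∑ x ∈ A', ∑ y ∈ A', g (x - y) ≤ A.card * S + (A'.card - A.card) * M := by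
    rw [← Finset.sum_sdiff hAA', add_comm]
    refine add_le_add (le_of_eq ?_) ?_
    · rw [← nsmul_eq_mul]
      exact Finset.sum_eq_card_nsmul fun x hx => sum_sub_left_eq_finsum hg hneg x (hA' x hx)
    · rw [← Finset.cast_card_sdiff hAA', ← nsmul_eq_mul]
      exact Finset.sum_le_card_nsmul _ _ _ fun x _ => sum_sub_left_le hg A' x
  set t : ℝ := L.card / A.card with ht
  have hquad : 0 ≤ L.card * g 0 - t * (L.card * S) - t * (L.card * S) +
      t ^ 2 * ∑ x ∈ A', ∑ y ∈ A', g (x - y) := by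
    have h := hf.re_sum_nonneg A' (fun x => (if x ∈ L then 1 else 0) - t)
    refine h.trans_eq ?_
    nth_rewrite 1 [← hleft]
    rw [← hright, ← hdiag]
    have hind : ∀ F : G → ℝ, ∑ x ∈ L, F x = ∑ x ∈ A', (if x ∈ L then 1 else 0) * F x := by
      intro F
      simp only [ite_mul, one_mul, zero_mul]
      rw [Finset.sum_ite_mem, Finset.inter_eq_right.2 hLA']
    simp only [hind, Finset.mul_sum, ← Finset.sum_sub_distrib, ← Finset.sum_add_distrib]
    exact Finset.sum_congr rfl fun x _ => Finset.sum_congr rfl fun y _ => by ring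
  have hquad' : 0 ≤ L.card * g 0 - t * (L.card * S) - t * (L.card * S) +
      t ^ 2 * (A.card * S + (A'.card - A.card) * M) :=
    hquad.trans (by gcongr)
  have hrw : L.card * g 0 - t * (L.card * S) - t * (L.card * S) +
      t ^ 2 * (A.card * S + (A'.card - A.card) * M) =
      (L.card * t) * (A.card / L.card * g 0 + ((A'.card : ℝ) / A.card - 1) * M - S) := by
    rw [ht]
    field_simp
    ring
  rw [hrw] at hquad'
  have hpos : 0 < L.card * t := by positivity
  have hmain := nonneg_of_mul_nonneg_right hquad' hpos
  have hratio : (A.card : ℝ) / L.card * g 0 ≤ P.card * g 0 :=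
    mul_le_mul_of_nonneg_right ((div_le_iff₀ hLpos).2 hcardR) hf.re_zero_nonneg
  linarith

lemma tendsto_box_card_ratio (d k : ℕ) :
    Tendsto (fun n : ℕ => ((2 * (n + k : ℝ) + 1) ^ d) / ((2 * (n : ℝ) + 1) ^ d)) atTop (𝓝 1) := by
  have h : Tendsto (fun n : ℕ => 1 + (2 * k : ℝ) / (2 * (n : ℝ) + 1)) atTop (𝓝 (1 + 0)) := by
    refine tendsto_const_nhds.add (tendsto_const_nhds.div_atTop ?_)
    exact tendsto_atTop_add_const_right _ _
      (tendsto_natCast_atTop_atTop.const_mul_atTop two_pos)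
  have h' := h.pow d
  rw [add_zero, one_pow] at h'
  refine h'.congr fun n => ?_
  rw [← div_pow]
  congr 1
  field_simp
  ring

lemma card_box (d n : ℕ) :
    ((Fintype.piFinset fun _ : Fin d => Finset.Icc (-(n : ℤ)) n).card : ℝ) =
      (2 * (n : ℝ) + 1) ^ d := by
  have h : ((n : ℤ) + 1 + (n : ℤ)).toNat = 2 * n + 1 := by omega
  simp [h]

theorem turan_bound_dispersed_Zd
    {d : ℕ} (hd : 0 < d) (Ω : Set (Fin d → ℤ)) (hΩfin : Ω.Finite)
    (hΩ0 : (0 : Fin d → ℤ) ∈ Ω) (hΩsym : Ω = -Ω)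
    (f : (Fin d → ℤ) → ℂ) (hf_pd : IsPosDefFn f)
    (hf_supp : Function.support f ⊆ Ω) :
    (∑ᶠ x, f x).re ≤ ({x ∈ Ω | 0 ≤ x ⟨0, hd⟩}.ncard : ℝ) * (f 0).re := by
  set O := hΩfin.toFinset with hO
  have hneg : ∀ x ∈ O, -x ∈ O := by
    intro x hx
    rw [hO, hΩfin.mem_toFinset] at hx ⊢
    rw [hΩsym] at hx
    exact hx
  have hPfin : {x ∈ Ω | 0 ≤ x ⟨0, hd⟩}.Finite := hΩfin.subset fun x hx => hx.1
  have hg : Function.support (fun x => (f x).re) ⊆ O := by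
    intro x hx
    rw [hO, hΩfin.coe_toFinset]
    exact hf_supp fun h => hx (by simp [h])
  obtain ⟨k, hk⟩ : ∃ k : ℕ, ∀ x ∈ O, ∀ i, |x i| ≤ k := by
    refine ⟨∑ x ∈ O, ∑ i, (x i).natAbs, fun x hx i => ?_⟩
    rw [Int.abs_eq_natAbs, Nat.cast_le]
    exact (Finset.single_le_sum (f := fun i => (x i).natAbs) (fun _ _ => Nat.zero_le _)
      (Finset.mem_univ i)).trans (Finset.single_le_sum
        (f := fun x : Fin d → ℤ => ∑ i, (x i).natAbs) (fun _ _ => Nat.zero_le _) hx)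
  have hre : (∑ᶠ x, f x).re = ∑ᶠ x, (f x).re :=
    Complex.reAddGroupHom.map_finsum (hΩfin.subset hf_supp)
  have hlim := ((tendsto_box_card_ratio d k).sub_const 1).mul_const (∑ x ∈ O, |(f x).re|)
    |>.const_add (({x ∈ Ω | 0 ≤ x ⟨0, hd⟩}.ncard : ℝ) * (f 0).re)
  rw [sub_self, zero_mul, add_zero] at hlim
  rw [hre]
  refine ge_of_tendsto' hlim fun n => ?_
  have h := hf_pd.finsum_re_le_add_boundary (Pi.evalAddMonoidHom (fun _ : Fin d => ℤ) ⟨0, hd⟩)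
    O hPfin.toFinset (hΩfin.mem_toFinset.2 hΩ0) hneg
    (fun x hx hx0 => hPfin.mem_toFinset.2 ⟨hΩfin.mem_toFinset.1 hx, hx0⟩) hg
    (A := Fintype.piFinset fun _ : Fin d => Finset.Icc (-(n : ℤ)) n)
    (A' := Fintype.piFinset fun _ : Fin d => Finset.Icc (-((n + k : ℕ) : ℤ)) (n + k : ℕ))
    ⟨0, by simp⟩ (by
      intro a ha o ho
      rw [Fintype.mem_piFinset] at ha ⊢
      intro i
      have h1 := Finset.mem_Icc.1 (ha i)
      have h2 := abs_le.1 (hk o ho i)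
      rw [Finset.mem_Icc, Pi.add_apply]
      push_cast
      constructor <;> linarith)
  rw [card_box, card_box, ← Set.ncard_eq_toFinset_card _ hPfin] at h
  push_cast at h
  exact h
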